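/- arXiv:math/0506114 — 2 statements merged into one kernel-verified Lean document; each statement's English description precedes it below -/
import Mathlib

section
/- Let K be a field of arbitrary characteristic and let G be a subgroup of GL_n(K). Then the subgroup of the holomorph Hol(G) = G ⋊ Aut(G) generated by the canonical normal copy of G and the image of the inner automorphism group Inn(G) (the range of the conjugation homomorphism G → Aut(G)) admits an injective group homomorphism into GL_{2n⁴}(K). -/
/-- A faithful linear representation of a group on a vector space of dimension at most `N`
gives an embedding into `GL_N`. -/
theorem exists_injective_hom_GL_of_finrank_le {K W H : Type*} [Field K] [AddCommGroup W]
    [Module K W] [FiniteDimensional K W] [Group H] (f : H →* Module.End K W)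
    (hf : Function.Injective f) {N : ℕ} (hN : Module.finrank K W ≤ N) :
    ∃ ρ : H →* GL (Fin N) K, Function.Injective ρ := by
  let V := W × (Fin (N - Module.finrank K W) → K)
  have hV : Module.finrank K V = N := by
    simp only [V, Module.finrank_prod, Module.finrank_fin_fun]
    omega
  let b : Module.Basis (Fin N) K V := Module.finBasisOfFinrankEq K V hV
  let F : H →* Module.End K V :=
    { toFun := fun h => LinearMap.prodMap (f h) LinearMap.id
      map_one' := by ext <;> simp
      map_mul' := fun x y => by ext <;> simp }
  have hF : Function.Injective F := by
    intro x y hxy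
    apply hf
    ext w
    have := congrArg Prod.fst (LinearMap.congr_fun hxy (w, 0))
    exact this
  refine ⟨(((LinearMap.toMatrixAlgEquiv b : _ →* Matrix (Fin N) (Fin N) K)).comp F).toHomUnits,
    fun x y hxy => hF ((LinearMap.toMatrixAlgEquiv b).injective ?_)⟩
  exact congrArg Units.val hxy

/-- An element of the subgroup of the holomorph generated by `G` and `Inn(G)` has an inner
automorphism as its second component. -/
theorem exists_conj_eq_right_of_mem_sup {G : Type*} [Group G]
    {s : G ⋊[MonoidHom.id (MulAut G)] MulAut G}
    (hs : s ∈ (SemidirectProduct.inl.range ⊔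
        (SemidirectProduct.inr.comp (MulAut.conj : G →* MulAut G)).range :
          Subgroup (G ⋊[MonoidHom.id (MulAut G)] MulAut G))) :
    ∃ h : G, MulAut.conj h = s.right := by
  have hle : (SemidirectProduct.inl.range ⊔
        (SemidirectProduct.inr.comp (MulAut.conj : G →* MulAut G)).range :
          Subgroup (G ⋊[MonoidHom.id (MulAut G)] MulAut G)) ≤
      (MulAut.conj : G →* MulAut G).range.comap SemidirectProduct.rightHom := by
    refine sup_le ?_ ?_
    · rintro _ ⟨g, rfl⟩
      exact ⟨1, by simp⟩
    · rintro _ ⟨g, rfl⟩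
      exact ⟨g, by simp⟩
  exact hle hs

/-- **Corollary 1.** Let `K` be a field of arbitrary characteristic and `G ≤ GL_n(K)`.
Then the subgroup `Inn(G)·G` of the holomorph `Hol(G) = G ⋊ Aut(G)` (generated by the
canonical normal copy of `G` and the image of the inner automorphism group `Inn(G)`)
embeds in `GL_{2n⁴}(K)`. -/
theorem innG_G_embeds {K : Type*} [Field K] (n : ℕ) (G : Subgroup (GL (Fin n) K)) :
    ∃ ρ : ↥((SemidirectProduct.inl.range ⊔
        (SemidirectProduct.inr.comp (MulAut.conj : G →* MulAut G)).range :
          Subgroup (G ⋊[MonoidHom.id (MulAut G)] MulAut G))) →* GL (Fin (2 * n ^ 4)) K,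
      Function.Injective ρ := by
  let v : G → Matrix (Fin n) (Fin n) K := fun x => ((x : GL (Fin n) K) : Matrix _ _ K)
  have hv : Function.Injective v := fun x y h => Subtype.ext (Units.ext h)
  let W := Submodule.span K (Set.range v)
  let w : G → W := fun x => ⟨v x, Submodule.subset_span ⟨x, rfl⟩⟩
  have hw : Function.Injective w := fun x y h => hv (congrArg Subtype.val h)
  have hspan : Submodule.span K (Set.range w) = ⊤ := by
    convert Submodule.span_span_coe_preimage (R := K) (s := Set.range v) using 2
    ext x
    simp [w, Subtype.ext_iff]
  have hext : ∀ f g : Module.End K W, (∀ x, f (w x) = g (w x)) → f = g := fun f g h =>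
    LinearMap.ext_on_range hspan h
  have key : ∀ s : ↥((SemidirectProduct.inl.range ⊔
        (SemidirectProduct.inr.comp (MulAut.conj : G →* MulAut G)).range :
          Subgroup (G ⋊[MonoidHom.id (MulAut G)] MulAut G))),
      ∃ F : Module.End K W, ∀ x, F (w x) = w (s.1.left * s.1.right x) := by
    intro s
    obtain ⟨h, hh⟩ := exists_conj_eq_right_of_mem_sup s.2
    let L : Module.End K (Matrix (Fin n) (Fin n) K) :=
      LinearMap.mulLeft K (v (s.1.left * h)) ∘ₗ LinearMap.mulRight K (v h⁻¹)
    have hL : ∀ x, L (v x) = v (s.1.left * s.1.right x) := by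
      intro x
      rw [← hh]
      simp [L, v, mul_assoc]
    have hLW : ∀ x ∈ W, L x ∈ W := by
      change W ≤ W.comap L
      refine Submodule.span_le.2 ?_
      rintro _ ⟨x, rfl⟩
      exact Submodule.subset_span ⟨_, (hL x).symm⟩
    exact ⟨L.restrict hLW, fun x => Subtype.ext (hL x)⟩
  choose F hF using key
  refine exists_injective_hom_GL_of_finrank_le
    (⟨⟨F, hext _ _ fun x => ?_⟩, fun s t => hext _ _ fun x => ?_⟩ : _ →* Module.End K W)
    (fun s t hst => ?_) ?_
  · simp [hF]
  · simp [hF, mul_assoc]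
  · have hst' : F s = F t := hst
    have h : ∀ x, s.1.left * s.1.right x = t.1.left * t.1.right x := fun x => hw <| by
      rw [← hF, ← hF, hst']
    have h1 : s.1.left = t.1.left := by simpa using h 1
    refine Subtype.ext (SemidirectProduct.ext h1 (MulEquiv.ext fun x => ?_))
    simpa [h1] using h x
  · calc Module.finrank K W ≤ Module.finrank K (Matrix (Fin n) (Fin n) K) :=
          Submodule.finrank_le W
      _ = n ^ 2 := by simp [Module.finrank_matrix, sq]
      _ ≤ 2 * n ^ 4 := by
        rcases Nat.eq_zero_or_pos n with rfl | hn
        · simp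
        · have := Nat.pow_le_pow_right hn (show 2 ≤ 4 by norm_num)
          omega
end

section
/- Let n ≥ 1 and let A(2n+1) = ⟨x, y ‖ (xy)ⁿ x = (yx)ⁿ y⟩ be the 2-generated Artin group, and let p be a prime number. Then A(2n+1) admits a faithful linear representation by matrices of degree 4(2n+1) over the ring ℤ[1/p] of rational numbers whose denominators are powers of p; that is, there is an injective group homomorphism A(2n+1) → GL_{4(2n+1)}(ℤ[1/p]). -/
open scoped MatrixGroups

/-- The defining relation of the 2-generated Artin group
`A(2n+1) = ⟨x, y ‖ (xy)ⁿ x = (yx)ⁿ y⟩`. -/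
def artinOddRels (n : ℕ) : Set (FreeGroup (Fin 2)) :=
  {(FreeGroup.of 0 * FreeGroup.of 1) ^ n * FreeGroup.of 0 *
    ((FreeGroup.of 1 * FreeGroup.of 0) ^ n * FreeGroup.of 1)⁻¹}

/-- The 2-generated Artin group `A(2n+1)`. -/
abbrev ArtinOdd (n : ℕ) := PresentedGroup (artinOddRels n)

/-- `ℤ[1/p]`: the subring of `ℚ` generated by `1/p`, i.e. the rational numbers whose
denominators are powers of `p`. -/
def ZinvP (p : ℕ) : Subring ℚ := Subring.closure {((p : ℚ))⁻¹}

/-- The ping-pong lemma for a group generated by an element `a` with at least three distinct powers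
and an involution `d`. -/
theorem injective_of_ping_pong {Q K α : Type*} [Group Q] [Group K] [MulAction K α] (φ : Q →* K)
    {a d : Q} (hgen : Subgroup.closure {a, d} = ⊤) (hd : d ^ 2 = 1)
    (hcard : 3 ≤ Cardinal.mk (Subgroup.zpowers a)) {X Y : Set α} (hX : X.Nonempty)
    (hY : Y.Nonempty) (hXY : Disjoint X Y)
    (ha : ∀ k : ℤ, a ^ k ≠ 1 → ∀ v ∈ Y, φ a ^ k • v ∈ X) (hdX : ∀ v ∈ X, φ d • v ∈ Y) :
    Function.Injective φ := by
  let H : Bool → Subgroup Q := fun b => Subgroup.zpowers (bif b then a else d)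
  let ψ : Monoid.CoprodI (fun b => H b) →* Q := Monoid.CoprodI.lift fun b => (H b).subtype
  have hψ : Function.Surjective ψ := by
    rw [← MonoidHom.range_eq_top, Monoid.CoprodI.range_eq_iSup, eq_top_iff, ← hgen,
      Subgroup.closure_le]
    rintro g (rfl | rfl)
    · exact Subgroup.mem_iSup_of_mem true (by simp [H])
    · exact Subgroup.mem_iSup_of_mem false (by simp [H])
  have hcomp : φ.comp ψ = Monoid.CoprodI.lift fun b => φ.comp (H b).subtype := by
    ext b h
    simp [ψ]
  have hinj : Function.Injective (φ.comp ψ) := by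
    rw [hcomp]
    refine Monoid.CoprodI.lift_injective_of_ping_pong _ (Or.inr ⟨true, hcard⟩)
      (fun b => bif b then X else Y) ?_ ?_ ?_
    · rintro (_ | _)
      exacts [hY, hX]
    · rintro (_ | _) (_ | _) h
      exacts [absurd rfl h, hXY.symm, hXY, absurd rfl h]
    · rintro (_ | _) (_ | _) hne ⟨_, k, rfl⟩ h
      · exact absurd rfl hne
      · rintro _ ⟨v, hv, rfl⟩
        have hk : d ^ k = d := by
          obtain ⟨j, rfl | rfl⟩ := Int.even_or_odd' k
          · exact absurd (Subtype.ext (by simp [zpow_mul, hd])) h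
          · rw [zpow_add, zpow_mul]
            simp [hd]
        simpa [hk] using hdX v hv
      · rintro _ ⟨v, hv, rfl⟩
        simpa using ha k (fun hk => h (Subtype.ext (by simpa using hk))) v hv
      · exact absurd rfl hne
  intro g₁ g₂ hg
  obtain ⟨w₁, rfl⟩ := hψ g₁
  obtain ⟨w₂, rfl⟩ := hψ g₂
  exact congrArg ψ (hinj hg)

namespace ArtinOdd

/-- The generator `xy` of `A(2n+1)`. -/
def rot (n : ℕ) : ArtinOdd n := PresentedGroup.of 0 * PresentedGroup.of 1

/-- The generator `(xy)ⁿ x` of `A(2n+1)`. -/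
def flip (n : ℕ) : ArtinOdd n := rot n ^ n * PresentedGroup.of 0

theorem flip_eq (n : ℕ) :
    flip n = (PresentedGroup.of 1 * PresentedGroup.of 0) ^ n * PresentedGroup.of 1 := by
  rw [← mul_inv_eq_one]
  exact PresentedGroup.one_of_mem (rels := artinOddRels n) rfl

theorem flip_sq (n : ℕ) : flip n ^ 2 = rot n ^ (2 * n + 1) := by
  have key : ∀ x y : ArtinOdd n, (y * x) ^ n = y * (x * y) ^ n * y⁻¹ := fun x y => by
    rw [← conj_pow]
    group
  calc flip n ^ 2 = flip n * flip n := sq _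
    _ = rot n ^ n * PresentedGroup.of 0 *
          ((PresentedGroup.of 1 * PresentedGroup.of 0) ^ n * PresentedGroup.of 1) := by
        conv_lhs => rw [flip_eq n]
        rw [← flip_eq n]; rfl
    _ = rot n ^ n * rot n * rot n ^ n := by rw [key, rot]; group
    _ = rot n ^ (2 * n + 1) := by rw [← pow_succ, ← pow_add]; ring_nf

theorem closure_rot_flip (n : ℕ) : Subgroup.closure {rot n, flip n} = ⊤ := by
  have ha : rot n ∈ Subgroup.closure {rot n, flip n} := Subgroup.subset_closure (by simp)
  have hd : flip n ∈ Subgroup.closure {rot n, flip n} := Subgroup.subset_closure (by simp)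
  have hx : PresentedGroup.of 0 ∈ Subgroup.closure {rot n, flip n} := by
    simpa [flip] using mul_mem (inv_mem (pow_mem ha n)) hd
  have hy : PresentedGroup.of 1 ∈ Subgroup.closure {rot n, flip n} := by
    simpa [rot] using mul_mem (inv_mem hx) ha
  rw [eq_top_iff, ← PresentedGroup.closure_range_of, Subgroup.closure_le]
  rintro _ ⟨i, rfl⟩
  fin_cases i
  exacts [hx, hy]

theorem flip_sq_mem_center (n : ℕ) : flip n ^ 2 ∈ Subgroup.center (ArtinOdd n) := by
  rw [← Subgroup.centralizer_univ, ← Subgroup.coe_top, ← closure_rot_flip,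
    Subgroup.centralizer_closure, Subgroup.mem_centralizer_iff]
  rintro g (rfl | rfl)
  · rw [flip_sq]
    exact (Commute.refl _).pow_right _
  · exact (Commute.refl _).pow_right _

/-- The homomorphism out of `A(2n+1)` determined by the images of `xy` and `(xy)ⁿ x`. -/
def lift {K : Type*} [Group K] (n : ℕ) (A S : K) (h : S ^ 2 = A ^ (2 * n + 1)) :
    ArtinOdd n →* K :=
  PresentedGroup.toGroup (f := ![(A ^ n)⁻¹ * S, S⁻¹ * A ^ (n + 1)]) (by
    rintro _ rfl
    have h₁ : (A ^ n)⁻¹ * S * (S⁻¹ * A ^ (n + 1)) = A := by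
      rw [pow_succ]
      group
    have h₂ : (S⁻¹ * A ^ (n + 1) * ((A ^ n)⁻¹ * S)) ^ n = S⁻¹ * A ^ n * S := by
      have : S⁻¹ * A ^ (n + 1) * ((A ^ n)⁻¹ * S) = S⁻¹ * A * S⁻¹⁻¹ := by
        rw [pow_succ']
        group
      rw [this, conj_pow, inv_inv]
    simp only [map_mul, map_pow, map_inv, FreeGroup.lift_apply_of, Matrix.cons_val_zero,
      Matrix.cons_val_one, h₁, h₂, mul_inv_eq_one]
    have h₃ : S * S = A ^ n * A ^ (n + 1) := by
      rw [← sq, h, ← pow_add]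
      ring_nf
    calc A ^ n * ((A ^ n)⁻¹ * S) = S⁻¹ * (S * S) := by group
      _ = S⁻¹ * A ^ n * S * (S⁻¹ * A ^ (n + 1)) := by rw [h₃]; group)

section

variable {K : Type*} [Group K] (n : ℕ) (A S : K) (h : S ^ 2 = A ^ (2 * n + 1))

theorem lift_rot : lift n A S h (rot n) = A := by
  simp only [lift, rot, map_mul, PresentedGroup.toGroup.of, Matrix.cons_val_zero,
    Matrix.cons_val_one, pow_succ]
  group

theorem lift_flip : lift n A S h (flip n) = S := by
  rw [flip, map_mul, map_pow, lift_rot]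
  simp [lift]

end

/-- Elements of `A(2n+1)` are separated by a homomorphism that is injective on the infinite cyclic
central subgroup generated by the square of `(xy)ⁿ x` together with a ping-pong action of the
quotient by that subgroup. -/
theorem eq_one_of_ping_pong {K L α : Type*} [Group K] [Group L] [MulAction K α] {n : ℕ}
    (hn : 1 ≤ n) {A S : K} (hS : S ^ 2 = 1) (hA : A ^ (2 * n + 1) = 1)
    (hA' : ∀ k : ℤ, A ^ k = 1 → ((2 * n + 1 : ℕ) : ℤ) ∣ k) {X Y : Set α} (hX : X.Nonempty)
    (hY : Y.Nonempty) (hXY : Disjoint X Y)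
    (hAY : ∀ k : ℤ, A ^ k ≠ 1 → ∀ v ∈ Y, A ^ k • v ∈ X) (hSX : ∀ v ∈ X, S • v ∈ Y)
    (χ : ArtinOdd n →* L) (hχ : ∀ k : ℤ, χ ((flip n ^ 2) ^ k) = 1 → k = 0) {g : ArtinOdd n}
    (hρg : lift n A S (hS.trans hA.symm) g = 1) (hχg : χ g = 1) : g = 1 := by
  set ρ := lift n A S (hS.trans hA.symm)
  let Z := Subgroup.zpowers (flip n ^ 2)
  have hZ : Z ≤ Subgroup.center (ArtinOdd n) := by
    simpa [Z, Subgroup.zpowers_le] using flip_sq_mem_center n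
  have : Z.Normal := ⟨fun z hz g => by
    rwa [(Subgroup.mem_center_iff.1 (hZ hz) g), mul_inv_cancel_right]⟩
  have hker : Z ≤ ρ.ker := by
    simp [Z, Subgroup.zpowers_le, MonoidHom.mem_ker, ρ, lift_flip, hS]
  let φ : ArtinOdd n ⧸ Z →* K := QuotientGroup.lift Z ρ hker
  let π := QuotientGroup.mk' Z
  have hφa : φ (π (rot n)) = A := lift_rot n A S (hS.trans hA.symm)
  have hφd : φ (π (flip n)) = S := lift_flip n A S (hS.trans hA.symm)
  have hπd : π (flip n) ^ 2 = 1 := by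
    rw [← map_pow]
    exact (QuotientGroup.eq_one_iff _).2 (Subgroup.mem_zpowers _)
  have hπa : π (rot n) ^ (2 * n + 1) = 1 := by
    rw [← map_pow, ← flip_sq, map_pow, hπd]
  have hord : orderOf (π (rot n)) = 2 * n + 1 := by
    refine Nat.dvd_antisymm (orderOf_dvd_of_pow_eq_one hπa) ?_
    have := hA' (orderOf (π (rot n))) (by
      rw [zpow_natCast, ← hφa, ← map_pow, pow_orderOf_eq_one, map_one])
    exact_mod_cast this
  have hinj : Function.Injective φ := by
    refine injective_of_ping_pong φ (a := π (rot n)) (d := π (flip n)) ?_ hπd ?_ hX hY hXY ?_ ?_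
    · rw [← Set.image_pair, ← MonoidHom.map_closure, closure_rot_flip,
        ← MonoidHom.range_eq_map, MonoidHom.range_eq_top]
      exact QuotientGroup.mk'_surjective Z
    · have hfin : Nat.card (Subgroup.zpowers (π (rot n))) = 2 * n + 1 := by
        rw [Nat.card_zpowers, hord]
      have : Finite (Subgroup.zpowers (π (rot n))) := Nat.finite_of_card_ne_zero (by omega)
      rw [← Nat.cast_card, hfin]
      exact_mod_cast (by omega : 3 ≤ 2 * n + 1)
    · intro k hk v hv
      rw [hφa]
      refine hAY k (fun h => hk ?_) v hv
      obtain ⟨j, rfl⟩ := hA' k h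
      rw [zpow_mul, zpow_natCast, hπa, one_zpow]
    · rwa [hφd]
  have hg : g ∈ Z := (QuotientGroup.eq_one_iff g).1 (hinj (by rw [map_one]; exact hρg))
  obtain ⟨k, rfl⟩ := hg
  simp [hχ k hχg]

end ArtinOdd

section Reflection

variable (R : Type*) [CommRing R] (m : ℕ)

/-- The cyclic shift of the coordinates of `R ^ m`. -/
def cyclicShift : (ZMod m → R) ≃ₗ[R] (ZMod m → R) :=
  LinearEquiv.funCongrLeft R R (Equiv.addRight 1)

/-- A reflection of the (dual) geometric representation of the universal Coxeter group. -/
def coxeterReflection : (ZMod m → R) ≃ₗ[R] (ZMod m → R) :=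
  LinearEquiv.ofInvolutive
    { toFun := fun v i => if i = 0 then -v 0 else v i + 2 * v 0
      map_add' := fun v w => by ext i; simp only [Pi.add_apply]; split_ifs <;> ring
      map_smul' := fun c v => by
        ext i; simp only [Pi.smul_apply, smul_eq_mul, RingHom.id_apply]; split_ifs <;> ring }
    fun v => by
      ext i
      by_cases hi : i = 0 <;> simp [hi]

variable {R m}

theorem coxeterReflection_apply (v : ZMod m → R) (i : ZMod m) :
    coxeterReflection R m v i = if i = 0 then -v 0 else v i + 2 * v 0 := rfl

theorem coxeterReflection_sq : coxeterReflection R m ^ 2 = 1 := by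
  ext1 v
  rw [sq]
  exact (coxeterReflection R m).left_inv v

theorem cyclicShift_pow_apply (k : ℕ) (v : ZMod m → R) (i : ZMod m) :
    (cyclicShift R m ^ k) v i = v (i + k) := by
  induction k generalizing v i with
  | zero => simp
  | succ k ih =>
    rw [pow_succ, LinearEquiv.mul_apply, ih]
    simp [cyclicShift, LinearEquiv.funCongrLeft_apply, LinearMap.funLeft_apply, add_assoc]

theorem cyclicShift_zpow_apply (k : ℤ) (v : ZMod m → R) (i : ZMod m) :
    (cyclicShift R m ^ k) v i = v (i + k) := by
  obtain ⟨k, rfl | rfl⟩ := k.eq_nat_or_neg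
  · simpa using cyclicShift_pow_apply k v i
  · have h := cyclicShift_pow_apply k ((cyclicShift R m ^ (-k : ℤ)) v) (i - k)
    rw [← LinearEquiv.mul_apply, zpow_neg, zpow_natCast, mul_inv_cancel] at h
    simpa [sub_eq_add_neg] using h.symm

theorem cyclicShift_zpow_eq_one_iff [Nontrivial R] (k : ℤ) :
    cyclicShift R m ^ k = 1 ↔ (k : ZMod m) = 0 := by
  refine ⟨fun h => ?_, fun h => ?_⟩
  · have := cyclicShift_zpow_apply k (Pi.single (k : ZMod m) (1 : R)) 0
    rw [h] at this
    by_contra hk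
    simp [Ne.symm hk] at this
  · ext1 v
    ext i
    simp [cyclicShift_zpow_apply, h]

variable [LinearOrder R]

variable (R m) in
/-- The vectors whose `k`-th coordinate is negative and smaller in absolute value than the other
coordinates, all of which are positive. -/
def negChamber (k : ZMod m) : Set (ZMod m → R) := {v | v k < 0 ∧ ∀ j ≠ k, -v k < v j}

theorem cyclicShift_zpow_mem_negChamber (k : ℤ) {v : ZMod m → R} (hv : v ∈ negChamber R m 0) :
    (cyclicShift R m ^ k) v ∈ negChamber R m (-k) := by
  refine ⟨by simpa [cyclicShift_zpow_apply] using hv.1, fun j hj => ?_⟩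
  simpa [cyclicShift_zpow_apply] using hv.2 (j + k) (by rwa [Ne, add_eq_zero_iff_eq_neg])

variable [IsStrictOrderedRing R]

theorem negChamber_nonempty (k : ZMod m) : (negChamber R m k).Nonempty :=
  ⟨fun i => if i = k then -1 else 2, by simp, fun j hj => by simp [hj]⟩

theorem disjoint_negChamber {k l : ZMod m} (h : k ≠ l) :
    Disjoint (negChamber R m k) (negChamber R m l) := by
  rw [Set.disjoint_left]
  rintro v ⟨hk, hk'⟩ ⟨hl, -⟩
  linarith [hk' l h.symm]

theorem coxeterReflection_mem_negChamber {k : ZMod m} (hk : k ≠ 0) {v : ZMod m → R}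
    (hv : v ∈ negChamber R m k) : coxeterReflection R m v ∈ negChamber R m 0 := by
  obtain ⟨h₁, h₂⟩ := hv
  have h₀ := h₂ 0 hk.symm
  refine ⟨by simp only [coxeterReflection_apply, if_true]; linarith, fun j hj => ?_⟩
  simp only [coxeterReflection_apply, if_true, if_neg hj]
  by_cases hjk : j = k
  · subst hjk
    linarith
  · linarith [h₂ j hjk]

end Reflection

/-- The scalar `p` as a unit of `ℤ[1/p]`. -/
def ZinvP.unit {p : ℕ} (hp : p ≠ 0) : (ZinvP p)ˣ where
  val := p
  inv := ⟨(p : ℚ)⁻¹, Subring.subset_closure rfl⟩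
  val_inv := Subtype.ext (by simp [hp])
  inv_val := Subtype.ext (by simp [hp])

theorem ZinvP.unit_zpow_eq_one {p : ℕ} (hp : p.Prime) {k : ℤ}
    (h : ZinvP.unit hp.ne_zero ^ k = 1) : k = 0 := by
  have h' := congrArg (Units.map (ZinvP p).subtype.toMonoidHom) h
  rw [map_zpow, map_one, Units.ext_iff, Units.val_zpow_eq_zpow_val] at h'
  have hq : (p : ℚ) ^ k = 1 := by simpa [ZinvP.unit] using h'
  exact (zpow_eq_one_iff_right₀ (by positivity) (by exact_mod_cast hp.one_lt.ne')).1 hq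

/-- A pair consisting of an automorphism of a coordinate space and a unit scalar, as an invertible
block diagonal matrix. -/
def blockHom (R ι κ : Type*) [CommRing R] [Fintype ι] [DecidableEq ι] [Fintype κ]
    [DecidableEq κ] : ((ι → R) ≃ₗ[R] (ι → R)) × Rˣ →* GL (ι × Option κ) R :=
  (Units.map (Matrix.blockDiagonalRingHom ι (Option κ) R).toMonoidHom).comp
    ((MulEquiv.piUnits.symm.toMonoidHom).comp
      (MonoidHom.pi fun o => o.elim
        (((Matrix.GeneralLinearGroup.toLin.symm.toMonoidHom).comp
          (LinearMap.GeneralLinearGroup.generalLinearEquiv R (ι → R)).symm.toMonoidHom).comp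
            (MonoidHom.fst _ _))
        fun _ => (Units.map (Matrix.scalar ι).toMonoidHom).comp (MonoidHom.snd _ _)))

theorem blockHom_injective (R ι κ : Type*) [CommRing R] [Fintype ι] [DecidableEq ι] [Nonempty ι]
    [Fintype κ] [DecidableEq κ] [Nonempty κ] : Function.Injective (blockHom R ι κ) := by
  refine (Units.map_injective Matrix.blockDiagonal_injective).comp
    (MulEquiv.piUnits.symm.injective.comp ?_)
  rintro ⟨f, r⟩ ⟨g, s⟩ h
  obtain ⟨k⟩ := ‹Nonempty κ›
  refine Prod.ext ?_ ?_
  · exact (Matrix.GeneralLinearGroup.toLin.symm.injective.comp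
      (LinearMap.GeneralLinearGroup.generalLinearEquiv R (ι → R)).symm.injective)
        (congrFun h none)
  · exact Units.map_injective (fun _ _ => Matrix.scalar_inj.1) (congrFun h (some k))

/-- For `n ≥ 1` and a prime `p`, the Artin group `A(2n+1)` has a faithful linear
representation by matrices of degree `4(2n+1)` over the ring `ℤ[1/p]`. -/
theorem artin_odd_linear_over_Zp (n : ℕ) (hn : 1 ≤ n) (p : ℕ) (hp : p.Prime) :
    ∃ ρ : ArtinOdd n →* GL (Fin (4 * (2 * n + 1))) (ZinvP p), Function.Injective ρ := by
  have hm : NeZero (2 * n + 1) := ⟨by omega⟩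
  let A := cyclicShift (ZinvP p) (2 * n + 1)
  let S := coxeterReflection (ZinvP p) (2 * n + 1)
  let u := ZinvP.unit hp.ne_zero
  have hA : ∀ k : ℤ, A ^ k = 1 ↔ ((2 * n + 1 : ℕ) : ℤ) ∣ k := fun k => by
    rw [cyclicShift_zpow_eq_one_iff, ZMod.intCast_zmod_eq_zero_iff_dvd]
  have hA₁ : A ^ (2 * n + 1) = 1 := by
    rw [← zpow_natCast, hA]
  have hu : (u ^ (2 * n + 1)) ^ 2 = (u ^ 2) ^ (2 * n + 1) := pow_right_comm ..
  let χ := ArtinOdd.lift n (u ^ 2) (u ^ (2 * n + 1)) hu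
  have hχ : ∀ k : ℤ, χ ((ArtinOdd.flip n ^ 2) ^ k) = 1 → k = 0 := fun k hk => by
    rw [map_zpow, map_pow, ArtinOdd.lift_flip, ← pow_mul, ← zpow_natCast, ← zpow_mul] at hk
    have := ZinvP.unit_zpow_eq_one hp hk
    rcases mul_eq_zero.1 this with h | h
    · omega
    · exact h
  let ρ := ArtinOdd.lift n A S (coxeterReflection_sq.trans hA₁.symm)
  have hinj : Function.Injective (ρ.prod χ) := (injective_iff_map_eq_one _).2 fun g hg => by
    rw [MonoidHom.prod_apply, Prod.mk_eq_one] at hg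
    refine ArtinOdd.eq_one_of_ping_pong hn coxeterReflection_sq hA₁ (fun k => (hA k).1)
      (X := ⋃ k ≠ 0, negChamber (ZinvP p) (2 * n + 1) k) (Y := negChamber (ZinvP p) (2 * n + 1) 0) ?_
      (negChamber_nonempty 0) ?_ ?_ ?_ χ hχ hg.1 hg.2
    · obtain ⟨v, hv⟩ := negChamber_nonempty (R := ZinvP p) (m := 2 * n + 1) 1
      have : Fact (1 < 2 * n + 1) := ⟨by omega⟩
      exact ⟨v, Set.mem_biUnion (one_ne_zero : (1 : ZMod (2 * n + 1)) ≠ 0) hv⟩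
    · simp only [Set.disjoint_iUnion_left]
      exact fun k hk => disjoint_negChamber hk
    · intro k hk v hv
      refine Set.mem_biUnion (x := -(k : ZMod (2 * n + 1))) ?_
        (cyclicShift_zpow_mem_negChamber k hv)
      exact neg_ne_zero.2 fun h => hk ((cyclicShift_zpow_eq_one_iff k).2 h)
    · intro v hv
      simp only [Set.mem_iUnion] at hv
      obtain ⟨k, hk, hv⟩ := hv
      exact coxeterReflection_mem_negChamber hk hv
  let e : ZMod (2 * n + 1) × Option (Fin 3) ≃ Fin (4 * (2 * n + 1)) :=
    Fintype.equivFinOfCardEq (by simp [ZMod.card, mul_comm])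
  let E : GL (ZMod (2 * n + 1) × Option (Fin 3)) (ZinvP p) ≃*
      GL (Fin (4 * (2 * n + 1))) (ZinvP p) :=
    Units.mapEquiv (Matrix.reindexAlgEquiv (ZinvP p) (ZinvP p) e).toMulEquiv
  exact ⟨E.toMonoidHom.comp ((blockHom _ _ _).comp (ρ.prod χ)),
    E.injective.comp ((blockHom_injective _ _ _).comp hinj)⟩
end
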